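/- Let G be a reductive group over k acting on an affine variety X, let x ∈ X(k) have closed orbit Gx. Then the stabilizer G_x is reductive. -/

import Mathlib

open Matrix

variable {k : Type} [Field k]

/-- A subset of `k^m` is Zariski closed if it is the common zero locus of a set of
polynomials. -/
def IsZariskiClosedSet {m : ℕ} (X : Set (Fin m → k)) : Prop :=
  ∃ T : Set (MvPolynomial (Fin m) k),
    X = {v | ∀ p ∈ T, MvPolynomial.eval v p = 0}

/-- The coordinates (matrix entries together with the determinant of the inverse) of an
element of `GL n k`, as a point of affine space. -/
def glCoords {n : ℕ} (g : GL (Fin n) k) : (Fin n × Fin n) ⊕ Unit → k :=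
  Sum.elim (fun ij => (g : Matrix (Fin n) (Fin n) k) ij.1 ij.2)
    (fun _ => ((g⁻¹ : GL (Fin n) k) : Matrix (Fin n) (Fin n) k).det)

/-- A subgroup of `GL n k` is algebraic (Zariski closed) if it is cut out by polynomial
equations in the matrix entries. -/
def IsAlgebraicSubgroup {n : ℕ} (G : Subgroup (GL (Fin n) k)) : Prop :=
  ∃ T : Set (MvPolynomial (Fin n × Fin n) k),
    (G : Set (GL (Fin n) k)) =
      {g : GL (Fin n) k | ∀ p ∈ T, MvPolynomial.eval
        (fun ij => (g : Matrix (Fin n) (Fin n) k) ij.1 ij.2) p = 0}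

/-- A function on a subgroup of `GL n k` is regular if it is given by a polynomial in the
matrix entries and the inverse of the determinant. -/
def IsRegularOn {n : ℕ} (G : Subgroup (GL (Fin n) k)) (f : G → k) : Prop :=
  ∃ p : MvPolynomial ((Fin n × Fin n) ⊕ Unit) k,
    ∀ g : G, f g = MvPolynomial.eval (glCoords (g : GL (Fin n) k)) p

/-- A homomorphism `G →* GL m k` is a rational representation if all its matrix
coefficients are regular functions on `G`. -/
def IsRationalRep {n m : ℕ} (G : Subgroup (GL (Fin n) k))
    (ρ : G →* GL (Fin m) k) : Prop :=
  ∀ i j : Fin m, IsRegularOn G (fun g => (ρ g : Matrix (Fin m) (Fin m) k) i j)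

/-- A (closed) subgroup of `GL n k` is (linearly) reductive if every rational
representation of it is semisimple: every invariant subspace admits an invariant
complement. -/
def IsReductiveSubgroup {n : ℕ} (G : Subgroup (GL (Fin n) k)) : Prop :=
  ∀ (m : ℕ) (ρ : G →* GL (Fin m) k), IsRationalRep G ρ →
    ∀ W : Submodule k (Fin m → k),
      (∀ (g : G), ∀ v ∈ W, (ρ g : Matrix (Fin m) (Fin m) k).mulVec v ∈ W) →
      ∃ W' : Submodule k (Fin m → k), IsCompl W W' ∧
        ∀ (g : G), ∀ v ∈ W', (ρ g : Matrix (Fin m) (Fin m) k).mulVec v ∈ W'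

open scoped TensorProduct

theorem sum_trace_smul_eq_zero_of_isNilpotent {K C L ι : Type*} [Field K] [CommRing C] [Algebra K C]
    [IsReduced C] [Field L] [Algebra K L] [FiniteDimensional K L] [Fintype ι]
    (q : ι → C) (l : ι → L) (h : IsNilpotent (∑ i, q i ⊗ₜ[K] l i)) :
    ∑ i, Algebra.trace K L (l i) • q i = 0 := by
  have key : Algebra.trace C (C ⊗[K] L) (∑ i, q i ⊗ₜ[K] l i) =
      ∑ i, Algebra.trace K L (l i) • q i := by
    rw [map_sum]
    refine Finset.sum_congr rfl fun i _ => ?_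
    have h1 : q i ⊗ₜ[K] l i = q i • ((1 : C) ⊗ₜ[K] l i) := by
      simp [TensorProduct.smul_tmul']
    have h2 : Algebra.lmul C (C ⊗[K] L) ((1 : C) ⊗ₜ[K] l i) =
        (Algebra.lmul K L (l i)).baseChange C := by
      ext y; simp
    rw [h1, map_smul, Algebra.trace_apply, h2, LinearMap.trace_baseChange, Algebra.trace_apply,
      smul_eq_mul, Algebra.smul_def, mul_comm]
  rw [← key]
  exact (Algebra.isNilpotent_trace_of_isNilpotent h).eq_zero

theorem isNilpotent_of_forall_algHom_eq_zero {k C : Type*} [Field k] [IsAlgClosed k] [CommRing C]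
    [Algebra k C] [Algebra.FiniteType k C] (t : C) (h : ∀ χ : C →ₐ[k] k, χ t = 0) :
    IsNilpotent t := by
  have : IsJacobsonRing C := isJacobsonRing_of_finiteType (A := k)
  rw [← mem_nilradical, nilradical, Ideal.radical_eq_jacobson, Ideal.jacobson, Submodule.mem_sInf]
  rintro M ⟨-, hM⟩
  let : Field (C ⧸ M) := Ideal.Quotient.field M
  have : Module.Finite k (C ⧸ M) := finite_of_finite_type_of_isJacobsonRing k (C ⧸ M)
  let e : k ≃ₐ[k] (C ⧸ M) := AlgEquiv.ofBijective (Algebra.ofId k (C ⧸ M))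
    (IsAlgClosed.algebraMap_bijective_of_isIntegral)
  have h2 := h ((e.symm : (C ⧸ M) →ₐ[k] k).comp (Ideal.Quotient.mkₐ k M))
  simp at h2
  exact Ideal.Quotient.eq_zero_iff_mem.1 h2

universe u

theorem exists_generic_trace_coefficients_of_field {A B K BK ι : Type u} [CommRing A] [CommRing B]
    [Algebra A B] [Field K] [Algebra A K] [CharZero K] [CommRing BK] [Algebra K BK] [Algebra B BK]
    [Algebra A BK] [IsScalarTower A K BK] [IsScalarTower A B BK] (M : Submonoid A)
    [IsLocalization M K] [IsLocalization (Algebra.algebraMapSubmonoid B M) BK]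
    [IsReduced B] [FaithfulSMul A B] [IsNoetherianRing B]
    [Algebra.FiniteType K BK] [Fintype ι] (p : ι → B) (i₀ : ι) (hi₀ : p i₀ = 1) :
    ∃ c : ι → A, c i₀ ≠ 0 ∧ ∀ q : ι → B, IsNilpotent (∑ i, p i ⊗ₜ[A] q i) →
      ∑ i, c i • q i = 0 := by
  have hnt : Nontrivial BK := by
    by_contra hn
    rw [not_nontrivial_iff_subsingleton] at hn
    obtain ⟨⟨_, t, htM, rfl⟩, h⟩ := (IsLocalization.map_eq_zero_iff
      (Algebra.algebraMapSubmonoid B M) BK 1).1 (Subsingleton.elim _ _)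
    have ht0 : t = 0 := FaithfulSMul.algebraMap_injective A B (by simpa using h)
    have := (IsLocalization.map_units K (⟨t, htM⟩ : M)).ne_zero
    simp [ht0] at this
  have hredBK : IsReduced BK := isReduced_localizationPreserves
    (Algebra.algebraMapSubmonoid B M) BK ‹_›
  obtain ⟨m, hm⟩ := Ideal.exists_maximal BK
  let : Field (BK ⧸ m) := Ideal.Quotient.field m
  have hfin : Module.Finite K (BK ⧸ m) := finite_of_finite_type_of_isJacobsonRing K (BK ⧸ m)
  let l : ι → BK ⧸ m := fun i => Ideal.Quotient.mk m (algebraMap B BK (p i))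
  obtain ⟨s, hs⟩ := IsLocalization.exist_integer_multiples_of_finite M
    (fun i => Algebra.trace K (BK ⧸ m) (l i))
  choose c hc using hs
  obtain ⟨t, ht⟩ : ∃ t : M, ∀ b : B, algebraMap B BK b = 0 → (t : A) • b = 0 := by
    obtain ⟨S, hS⟩ : (RingHom.ker (algebraMap B BK)).FG := IsNoetherian.noetherian _
    have h1 : ∀ b : S, ∃ t : M, (t : A) • (b : B) = 0 := by
      intro b
      have hb : algebraMap B BK b = 0 := by
        have : (b : B) ∈ RingHom.ker (algebraMap B BK) := hS ▸ Ideal.subset_span b.2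
        exact this
      obtain ⟨⟨_, t, htM, rfl⟩, h⟩ :=
        (IsLocalization.map_eq_zero_iff (Algebra.algebraMapSubmonoid B M) BK _).1 hb
      exact ⟨⟨t, htM⟩, by rw [Algebra.smul_def]; exact h⟩
    choose t ht using h1
    have hle : RingHom.ker (algebraMap B BK) ≤
        LinearMap.ker (LinearMap.mulLeft B (algebraMap A B (∏ b, t b : M))) := by
      rw [← hS, Ideal.span, Submodule.span_le]
      intro x hx
      obtain ⟨u, hu⟩ := Finset.dvd_prod_of_mem t (Finset.mem_univ (⟨x, hx⟩ : S))
      have := ht ⟨x, hx⟩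
      rw [Algebra.smul_def] at this
      rw [SetLike.mem_coe, LinearMap.mem_ker, LinearMap.mulLeft_apply, hu, Submonoid.coe_mul,
        map_mul, mul_right_comm, this, zero_mul]
    exact ⟨∏ b, t b, fun b hb => by rw [Algebra.smul_def]; exact hle hb⟩
  refine ⟨fun i => t * c i, fun h0 => ?_, fun q hq => ?_⟩
  · have h1 := congrArg (algebraMap A K) h0
    rw [map_mul, map_zero, hc i₀] at h1
    have htr : Algebra.trace K (BK ⧸ m) (l i₀) = Module.finrank K (BK ⧸ m) := by
      have : l i₀ = algebraMap K (BK ⧸ m) 1 := by simp [l, hi₀]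
      rw [this, Algebra.trace_algebraMap]; simp
    rw [htr] at h1
    have h2 : (Module.finrank K (BK ⧸ m) : K) ≠ 0 := by
      exact_mod_cast (Module.finrank_pos (R := K) (M := BK ⧸ m)).ne'
    have h3 := fun u : M => (IsLocalization.map_units K u).ne_zero
    rw [Algebra.smul_def] at h1
    exact mul_ne_zero (h3 t) (mul_ne_zero (h3 s) h2) h1
  · let f : B →ₐ[A] BK ⊗[K] (BK ⧸ m) :=
      ((Algebra.TensorProduct.includeRight : (BK ⧸ m) →ₐ[K] BK ⊗[K] (BK ⧸ m)).restrictScalars A).comp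
        (((Ideal.Quotient.mkₐ K m).restrictScalars A).comp (IsScalarTower.toAlgHom A B BK))
    let g : B →ₐ[A] BK ⊗[K] (BK ⧸ m) :=
      ((Algebra.TensorProduct.includeLeft : BK →ₐ[K] BK ⊗[K] (BK ⧸ m)).restrictScalars A).comp
        (IsScalarTower.toAlgHom A B BK)
    have h1 := hq.map (Algebra.TensorProduct.productMap f g)
    have h2 : Algebra.TensorProduct.productMap f g (∑ i, p i ⊗ₜ[A] q i) =
        ∑ i, algebraMap B BK (q i) ⊗ₜ[K] l i := by
      rw [map_sum]
      refine Finset.sum_congr rfl fun i _ => ?_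
      simp [f, g, l]
    rw [h2] at h1
    have h3 := sum_trace_smul_eq_zero_of_isNilpotent _ _ h1
    have h4 : algebraMap B BK (∑ i, c i • q i) = 0 := by
      have h5 := congrArg (fun z => (s : A) • z) h3
      simp only [smul_zero, Finset.smul_sum] at h5
      rw [map_sum, ← h5]
      refine Finset.sum_congr rfl fun i _ => ?_
      rw [← smul_assoc, ← hc i, algebraMap_smul, Algebra.smul_def, Algebra.smul_def, map_mul,
        ← IsScalarTower.algebraMap_apply]
    have h6 := ht _ h4
    rw [Finset.smul_sum] at h6
    simpa [mul_smul] using h6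

theorem exists_generic_trace_coefficients {A B ι : Type u} [CommRing A] [CommRing B] [Algebra A B]
    [Algebra ℚ A] [IsReduced A] [IsReduced B] [Nontrivial A] [IsNoetherianRing B]
    [Algebra.FiniteType A B] [FaithfulSMul A B] [Fintype ι] (p : ι → B) (i₀ : ι) (hi₀ : p i₀ = 1) :
    ∃ c : ι → A, c i₀ ≠ 0 ∧ ∀ q : ι → B, IsNilpotent (∑ i, p i ⊗ₜ[A] q i) →
      ∑ i, c i • q i = 0 := by
  obtain ⟨P, hP⟩ := Ideal.nonempty_minimalPrimes (I := (⊥ : Ideal A)) bot_ne_top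
  have hPp : P.IsPrime := hP.1.1
  let K := Localization.AtPrime P
  have hK : IsField K := PrimeSpectrum.subsingleton_iff_isField_of_isReduced.1
    (IsLocalization.subsingleton_primeSpectrum_of_mem_minimalPrimes P hP K)
  let : Field K := hK.toField
  let : Algebra A K := OreLocalization.instAlgebra
  have : CharZero K := algebraRat.charZero K
  let : Algebra B (K ⊗[A] B) := Algebra.TensorProduct.rightAlgebra
  exact exists_generic_trace_coefficients_of_field (K := K) (BK := K ⊗[A] B) P.primeCompl p i₀ hi₀

theorem exists_generic_coefficients_of_points {k A B ι : Type} [Field k] [IsAlgClosed k] [CharZero k]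
    [CommRing A] [CommRing B] [Algebra k A] [Algebra k B] [Algebra A B] [IsScalarTower k A B]
    [IsReduced A] [IsReduced B] [Nontrivial A] [Algebra.FiniteType k B] [FaithfulSMul A B]
    [Fintype ι] (p : ι → B) (i₀ : ι) (hi₀ : p i₀ = 1) :
    ∃ c : ι → A, c i₀ ≠ 0 ∧ ∀ q : ι → B,
      (∀ χ₁ χ₂ : B →ₐ[k] k, (∀ a : A, χ₁ (algebraMap A B a) = χ₂ (algebraMap A B a)) →
        ∑ i, χ₁ (p i) * χ₂ (q i) = 0) →
      ∑ i, c i • q i = 0 := by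
  have : Algebra.FiniteType A B := Algebra.FiniteType.of_restrictScalars_finiteType k A B
  have : IsNoetherianRing B := Algebra.FiniteType.isNoetherianRing k B
  let : Algebra ℚ A := ((algebraMap k A).comp (algebraMap ℚ k)).toAlgebra
  have hft : Algebra.FiniteType B (B ⊗[A] B) := inferInstance
  have : Algebra.FiniteType k (B ⊗[A] B) := Algebra.FiniteType.trans (S := B) ‹_› hft
  obtain ⟨c, hc, h⟩ := exists_generic_trace_coefficients (A := A) p i₀ hi₀
  refine ⟨c, hc, fun q hq => h q (isNilpotent_of_forall_algHom_eq_zero (k := k) _ fun χ => ?_)⟩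
  let f : B →ₐ[k] B ⊗[A] B :=
    (Algebra.TensorProduct.includeLeft : B →ₐ[A] B ⊗[A] B).restrictScalars k
  let g : B →ₐ[k] B ⊗[A] B :=
    (Algebra.TensorProduct.includeRight : B →ₐ[A] B ⊗[A] B).restrictScalars k
  rw [← hq (χ.comp f) (χ.comp g) fun a => ?_, map_sum]
  · refine Finset.sum_congr rfl fun i _ => ?_
    rw [AlgHom.comp_apply, AlgHom.comp_apply, ← map_mul]
    simp [f, g]
  · rw [AlgHom.comp_apply, AlgHom.comp_apply]
    congr 1
    simp only [f, g, AlgHom.restrictScalars_apply]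
    rw [AlgHom.commutes, AlgHom.commutes]

theorem exists_generic_coefficients {k Y ι : Type} [Field k] [IsAlgClosed k] [CharZero k]
    [Nonempty Y] [Fintype ι] (A B : Subalgebra k (Y → k)) (hAB : A ≤ B) (hBfg : B.FG)
    (hpt : ∀ χ : B →ₐ[k] k, ∃ y : Y, ∀ b : B, χ b = (b : Y → k) y)
    (p : ι → B) (i₀ : ι) (hi₀ : p i₀ = 1) :
    ∃ c : ι → A, c i₀ ≠ 0 ∧ ∀ q : ι → B,
      (∀ y₁ y₂, (∀ a ∈ A, a y₁ = a y₂) →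
        ∑ i, (p i : Y → k) y₁ * (q i : Y → k) y₂ = 0) →
      ∀ y, ∑ i, (c i : Y → k) y * (q i : Y → k) y = 0 := by
  let : Algebra A B := (Subalgebra.inclusion hAB).toAlgebra
  have : IsScalarTower k A B := IsScalarTower.of_algebraMap_eq fun _ => rfl
  have : FaithfulSMul A B :=
    (faithfulSMul_iff_algebraMap_injective A B).2 (Subalgebra.inclusion_injective hAB)
  have : Algebra.FiniteType k B := B.fg_iff_finiteType.1 hBfg
  have : IsReduced A := isReduced_of_injective A.val Subtype.val_injective
  have : IsReduced B := isReduced_of_injective B.val Subtype.val_injective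
  obtain ⟨c, hc, h⟩ := exists_generic_coefficients_of_points (k := k) (A := A) p i₀ hi₀
  refine ⟨c, hc, fun q hq y => ?_⟩
  have h0 := h q fun χ₁ χ₂ hχ => ?_
  · have := congrFun (congrArg Subtype.val h0) y
    simp only [Algebra.smul_def, AddSubmonoidClass.coe_finsetSum, Finset.sum_apply] at this
    exact this
  · obtain ⟨y₁, h₁⟩ := hpt χ₁
    obtain ⟨y₂, h₂⟩ := hpt χ₂
    simp only [h₁, h₂] at hχ ⊢
    exact hq y₁ y₂ fun a ha => hχ ⟨a, ha⟩

/-- The algebra of regular functions on a subgroup of `GL n k`. -/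
noncomputable def regularFunctions {n : ℕ} (G : Subgroup (GL (Fin n) k)) : Subalgebra k (G → k) :=
  (MvPolynomial.aeval fun i (g : G) => glCoords (g : GL (Fin n) k) i).range

section RegularFunctions

variable {n : ℕ} {G : Subgroup (GL (Fin n) k)}

theorem aeval_pi_apply {σ X : Type*} (F : σ → X → k) (p : MvPolynomial σ k) (x : X) :
    MvPolynomial.aeval F p x = MvPolynomial.eval (fun i => F i x) p := by
  induction p using MvPolynomial.induction_on with
  | C a => simp
  | add p q hp hq => simp [hp, hq]
  | mul_X p i hp => simp [hp]

theorem mem_regularFunctions_iff {f : G → k} : f ∈ regularFunctions G ↔ IsRegularOn G f := by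
  constructor
  · rintro ⟨p, rfl⟩
    exact ⟨p, fun g => aeval_pi_apply _ p g⟩
  · rintro ⟨p, hp⟩
    exact ⟨p, funext fun g => (aeval_pi_apply _ p g).trans (hp g).symm⟩

theorem glCoords_mem_regularFunctions (i : (Fin n × Fin n) ⊕ Unit) :
    (fun g : G => glCoords (g : GL (Fin n) k) i) ∈ regularFunctions G :=
  ⟨MvPolynomial.X i, by simp⟩

theorem entry_mem_regularFunctions (i j : Fin n) :
    (fun g : G => (g : GL (Fin n) k) i j) ∈ regularFunctions G :=
  glCoords_mem_regularFunctions (Sum.inl (i, j))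

theorem det_inv_mem_regularFunctions :
    (fun g : G => ((g : GL (Fin n) k)⁻¹ : GL (Fin n) k).val.det) ∈ regularFunctions G :=
  glCoords_mem_regularFunctions (Sum.inr ())

theorem det_mem_of_entry_mem {X : Type*} {R : Subalgebra k (X → k)} {m : ℕ}
    (M : X → Matrix (Fin m) (Fin m) k) (hM : ∀ i j, (fun x => M x i j) ∈ R) :
    (fun x => (M x).det) ∈ R := by
  have : (fun x => (M x).det) =
      ∑ σ : Equiv.Perm (Fin m), (Equiv.Perm.sign σ : ℤ) • ∏ i, fun x => M x (σ i) i := by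
    ext x
    simp [Matrix.det_apply, Units.smul_def]
  rw [this]
  exact sum_mem fun σ _ => zsmul_mem (prod_mem fun i _ => hM _ _) _

theorem GL_inv_val_eq_det_smul_adjugate {m : ℕ} (g : GL (Fin m) k) :
    (g⁻¹).val = (g⁻¹).val.det • g.val.adjugate := by
  have h : (g⁻¹).val.det * g.val.det = 1 := by
    rw [← Matrix.det_mul, ← Units.val_mul, inv_mul_cancel, Units.val_one, Matrix.det_one]
  have h2 : (g⁻¹).val * (g.val * g.val.adjugate) = g.val.adjugate := by
    rw [← mul_assoc, ← Units.val_mul, inv_mul_cancel, Units.val_one, one_mul]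
  rw [Matrix.mul_adjugate] at h2
  rw [← h2, mul_smul_comm, mul_one, smul_smul, h, one_smul]

theorem inv_entry_mem {X : Type*} {R : Subalgebra k (X → k)} {m : ℕ}
    (M : X → GL (Fin m) k) (hM : ∀ i j, (fun x => (M x).val i j) ∈ R)
    (hdet : (fun x => ((M x)⁻¹).val.det) ∈ R) (i j : Fin m) :
    (fun x => ((M x)⁻¹).val i j) ∈ R := by
  have : (fun x => ((M x)⁻¹).val i j) =
      (fun x => ((M x)⁻¹).val.det) * fun x => (M x).val.adjugate i j := by
    ext x
    conv_lhs => rw [GL_inv_val_eq_det_smul_adjugate]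
    simp
  rw [this]
  refine mul_mem hdet ?_
  simp only [Matrix.adjugate_apply]
  refine det_mem_of_entry_mem _ fun a b => ?_
  by_cases h : a = j
  · subst h
    simp only [Matrix.updateRow_self]
    exact R.algebraMap_mem ((Pi.single i (1 : k) : Fin m → k) b)
  · simpa [Matrix.updateRow_ne h] using hM a b

theorem comp_inv_mem_regularFunctions {f : G → k} (hf : f ∈ regularFunctions G) :
    (fun g => f g⁻¹) ∈ regularFunctions G := by
  obtain ⟨p, rfl⟩ := AlgHom.mem_range _ |>.1 hf
  clear hf
  induction p using MvPolynomial.induction_on with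
  | C a => rw [MvPolynomial.aeval_C]; exact Subalgebra.algebraMap_mem _ a
  | add p q hp hq => rw [map_add]; exact add_mem hp hq
  | mul_X p i hp =>
    rw [map_mul]
    refine mul_mem hp ?_
    rcases i with ⟨i, j⟩ | _
    · simpa [glCoords] using inv_entry_mem (fun g : G => (g : GL (Fin n) k))
        entry_mem_regularFunctions det_inv_mem_regularFunctions i j
    · simpa [glCoords] using det_mem_of_entry_mem (fun g : G => (g : GL (Fin n) k).val)
        entry_mem_regularFunctions

theorem exists_comul {f : G → k} (hf : f ∈ regularFunctions G) :
    ∃ (ι : Type) (_ : Fintype ι) (p q : ι → G → k), (∀ i, p i ∈ regularFunctions G) ∧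
      (∀ i, q i ∈ regularFunctions G) ∧ ∀ g g', f (g * g') = ∑ i, p i g * q i g' := by
  obtain ⟨P, rfl⟩ := AlgHom.mem_range _ |>.1 hf
  clear hf
  induction P using MvPolynomial.induction_on with
  | C a =>
    refine ⟨Unit, inferInstance, fun _ => algebraMap k _ a, fun _ => 1,
      fun _ => Subalgebra.algebraMap_mem _ _, fun _ => one_mem _, by simp⟩
  | add P Q hP hQ =>
    obtain ⟨ι, _, p, q, hp, hq, h⟩ := hP
    obtain ⟨ι', _, p', q', hp', hq', h'⟩ := hQ
    refine ⟨ι ⊕ ι', inferInstance, Sum.elim p p', Sum.elim q q', by simp [hp, hp'],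
      by simp [hq, hq'], fun g g' => ?_⟩
    simp only [Fintype.sum_sum_type, Sum.elim_inl, Sum.elim_inr, ← h, ← h', map_add]
    rfl
  | mul_X P i hP =>
    obtain ⟨ι, _, p, q, hp, hq, h⟩ := hP
    obtain ⟨ι', _, p', q', hp', hq', h'⟩ : ∃ (ι : Type) (_ : Fintype ι) (p q : ι → G → k),
        (∀ i, p i ∈ regularFunctions G) ∧ (∀ i, q i ∈ regularFunctions G) ∧
        ∀ g g' : G, glCoords (g * g' : GL (Fin n) k) i = ∑ i, p i g * q i g' := by
      rcases i with ⟨i, j⟩ | _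
      · refine ⟨Fin n, inferInstance, fun l g => (g : GL (Fin n) k) i l,
          fun l g => (g : GL (Fin n) k) l j, fun l => entry_mem_regularFunctions _ _,
          fun l => entry_mem_regularFunctions _ _, fun g g' => ?_⟩
        simp [glCoords, Matrix.mul_apply]
      · refine ⟨Unit, inferInstance, fun _ g => ((g : GL (Fin n) k)⁻¹ : GL (Fin n) k).val.det,
          fun _ g => ((g : GL (Fin n) k)⁻¹ : GL (Fin n) k).val.det,
          fun l => det_inv_mem_regularFunctions,
          fun l => det_inv_mem_regularFunctions, fun g g' => ?_⟩
        simp only [glCoords, Sum.elim_inr, _root_.mul_inv_rev, Units.val_mul, Matrix.det_mul,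
          Finset.univ_unique, Finset.sum_const, Finset.card_singleton, one_smul]
        ring
    refine ⟨ι × ι', inferInstance, fun i => p i.1 * p' i.2, fun i => q i.1 * q' i.2,
      fun i => mul_mem (hp _) (hp' _), fun i => mul_mem (hq _) (hq' _), fun g g' => ?_⟩
    rw [map_mul, Pi.mul_apply, h, MvPolynomial.aeval_X, Subgroup.coe_mul, h',
      Finset.sum_mul_sum, Fintype.sum_prod_type]
    refine Finset.sum_congr rfl fun i _ => Finset.sum_congr rfl fun j _ => ?_
    simp only [Pi.mul_apply]
    ring

theorem comp_mul_left_mem_regularFunctions {f : G → k} (hf : f ∈ regularFunctions G) (g : G) :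
    (fun x => f (g * x)) ∈ regularFunctions G := by
  obtain ⟨ι, _, p, q, hp, hq, h⟩ := exists_comul hf
  have : (fun x => f (g * x)) = ∑ i, p i g • q i := by
    ext x; simp [h]
  rw [this]
  exact sum_mem fun i _ => Subalgebra.smul_mem _ (hq i) _

theorem comp_mul_right_mem_regularFunctions {f : G → k} (hf : f ∈ regularFunctions G) (g : G) :
    (fun x => f (x * g)) ∈ regularFunctions G := by
  obtain ⟨ι, _, p, q, hp, hq, h⟩ := exists_comul hf
  have : (fun x => f (x * g)) = ∑ i, q i g • p i := by
    ext x; simp [h, mul_comm]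
  rw [this]
  exact sum_mem fun i _ => Subalgebra.smul_mem _ (hp i) _

theorem regularFunctions_fg : (regularFunctions G).FG := by
  rw [regularFunctions, ← Algebra.adjoin_range_eq_range_aeval]
  exact ⟨(Set.finite_range _).toFinset, congrArg _ (Set.Finite.coe_toFinset _)⟩

theorem exists_eq_eval_of_algHom (halg : IsAlgebraicSubgroup G) (χ : regularFunctions G →ₐ[k] k) :
    ∃ g : G, ∀ f : regularFunctions G, χ f = (f : G → k) g := by
  let E (i j : Fin n) : regularFunctions G := ⟨_, entry_mem_regularFunctions i j⟩
  let D : regularFunctions G := ⟨_, det_inv_mem_regularFunctions⟩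
  let EM : Matrix (Fin n) (Fin n) (regularFunctions G) := Matrix.of E
  have hval (g : G) : EM.map (fun f => (f : G → k) g) = (g : GL (Fin n) k).val := rfl
  have hdet : EM.det * D = 1 := by
    ext g
    have h1 : ((EM.det : G → k)) g = (g : GL (Fin n) k).val.det := by
      rw [← hval g]
      exact RingHom.map_det ((Pi.evalRingHom _ g).comp (regularFunctions G).val.toRingHom) EM
    change (EM.det : G → k) g * ((g : GL (Fin n) k)⁻¹ : GL (Fin n) k).val.det = 1
    rw [h1, ← Matrix.det_mul, ← Units.val_mul, mul_inv_cancel, Units.val_one, Matrix.det_one]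
  let M : Matrix (Fin n) (Fin n) k := EM.map χ
  have hMD : M.det * χ D = 1 := by
    have := congrArg χ hdet
    rw [map_mul, map_one] at this
    rw [← this]
    congr 1
    exact (AlgHom.map_det χ EM).symm
  let γ : GL (Fin n) k := Matrix.GeneralLinearGroup.mkOfDetNeZero M (left_ne_zero_of_mul_eq_one hMD)
  have hγ : γ.val = M := rfl
  have hγD : (γ⁻¹).val.det = χ D := by
    have h2 : M.det * (γ⁻¹).val.det = 1 := by
      rw [← hγ, ← Matrix.det_mul, ← Units.val_mul, mul_inv_cancel, Units.val_one, Matrix.det_one]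
    exact mul_left_cancel₀ (left_ne_zero_of_mul_eq_one hMD) (h2.trans hMD.symm)
  obtain ⟨T, hT⟩ := halg
  have hγG : γ ∈ G := by
    rw [← SetLike.mem_coe, hT]
    intro p hp
    have h0 : MvPolynomial.aeval (fun ij : Fin n × Fin n => E ij.1 ij.2) p = 0 := by
      ext g
      have hg : (g : GL (Fin n) k) ∈ (G : Set (GL (Fin n) k)) := g.2
      rw [hT] at hg
      have h2 : (MvPolynomial.aeval (fun ij : Fin n × Fin n => (E ij.1 ij.2 : G → k)) p) g = 0 := by
        rw [aeval_pi_apply]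
        exact hg p hp
      refine Eq.trans ?_ h2
      exact congrFun (MvPolynomial.comp_aeval_apply (B := G → k) _
        (regularFunctions G).val p) g
    have h1 := congrArg χ h0
    rw [MvPolynomial.comp_aeval_apply, map_zero] at h1
    exact h1
  refine ⟨⟨γ, hγG⟩, fun ⟨f, hf⟩ => ?_⟩
  obtain ⟨P, rfl⟩ := AlgHom.mem_range _ |>.1 hf
  let C (i : (Fin n × Fin n) ⊕ Unit) : regularFunctions G := ⟨_, glCoords_mem_regularFunctions i⟩
  have hC : (⟨MvPolynomial.aeval (fun i (g : G) => glCoords (g : GL (Fin n) k) i) P, hf⟩ :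
      regularFunctions G) = MvPolynomial.aeval C P := by
    ext1
    exact (MvPolynomial.comp_aeval_apply (B := G → k) C (regularFunctions G).val P).symm
  have h1 : χ (MvPolynomial.aeval C P) = MvPolynomial.aeval (fun i => χ (C i)) P :=
    MvPolynomial.comp_aeval_apply _ _ _
  rw [hC, h1, ← hC]
  refine Eq.trans ?_ (aeval_pi_apply _ P _).symm
  rw [MvPolynomial.aeval_eq_eval]
  congr 2
  ext i
  rcases i with ⟨i, j⟩ | _
  · rfl
  · exact hγD.symm

end RegularFunctions

theorem exists_eval_combination {X : Type*} (U : Submodule k (X → k)) [FiniteDimensional k U]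
    (φ : U →ₗ[k] k) :
    ∃ c : X →₀ k, ∀ u : U, φ u = c.sum fun x a => a * (u : X → k) x := by
  let ev (x : X) : Module.Dual k U := (LinearMap.proj x).comp U.subtype
  have htop : Submodule.span k (Set.range ev) = ⊤ := by
    suffices h : (Submodule.span k (Set.range ev)).dualCoannihilator = ⊥ by
      rw [← Subspace.dualCoannihilator_dualAnnihilator_eq (W := Submodule.span k (Set.range ev)), h,
        Submodule.dualAnnihilator_bot]
    rw [eq_bot_iff]
    intro u hu
    rw [Submodule.mem_dualCoannihilator] at hu
    rw [Submodule.mem_bot]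
    ext x
    exact hu (ev x) (Submodule.subset_span ⟨x, rfl⟩)
  have hφ : φ ∈ Submodule.span k (Set.range ev) := htop ▸ Submodule.mem_top
  obtain ⟨c, hc⟩ := (Finsupp.mem_span_range_iff_exists_finsupp).1 hφ
  refine ⟨c, fun u => ?_⟩
  rw [← hc, Finsupp.sum, LinearMap.sum_apply]
  rfl

section Averaging

variable {n : ℕ} {G : Subgroup (GL (Fin n) k)}

/-- The right translation action on functions. -/
def rightTranslation (G : Type*) [Group G] : G →* Module.End k (G → k) where
  toFun g := LinearMap.funLeft k k (· * g)
  map_one' := by ext f x; simp [LinearMap.funLeft]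
  map_mul' g h := by ext f x; simp [LinearMap.funLeft, mul_assoc]

theorem exists_invariant_functional_of_stable (hred : IsReductiveSubgroup G)
    (U : Submodule k (G → k)) [FiniteDimensional k U] (hU : ∀ u ∈ U, u ∈ regularFunctions G)
    (hstab : ∀ g : G, ∀ u ∈ U, rightTranslation G g u ∈ U) (h1 : (1 : G → k) ∈ U) :
    ∃ ℓ : U →ₗ[k] k, ℓ ⟨1, h1⟩ = 1 ∧
      ∀ (g : G) (u : U), ℓ ⟨rightTranslation G g u, hstab g u u.2⟩ = ℓ u := by
  let τ : G →* Module.End k U :=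
    { toFun g := (rightTranslation G g).restrict (hstab g)
      map_one' := by ext u x; simp
      map_mul' g h := by ext u x; simp }
  let b := Module.finBasis k U
  let ρ : G →* GL (Fin (Module.finrank k U)) k :=
    ((LinearMap.toMatrixAlgEquiv b : Module.End k U →* _).comp τ).toHomUnits
  have hρ (g : G) : (ρ g : Matrix _ _ k) = LinearMap.toMatrix b b (τ g) := rfl
  have hρv (g : G) (u : U) : (ρ g : Matrix _ _ k) *ᵥ b.equivFun u = b.equivFun (τ g u) := by
    rw [hρ]; exact LinearMap.toMatrix_mulVec_repr b b (τ g) u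
  have hrat : IsRationalRep G ρ := by
    intro i j
    rw [← mem_regularFunctions_iff]
    obtain ⟨c, hc⟩ := exists_eval_combination U (b.coord i)
    have : (fun g => (ρ g : Matrix _ _ k) i j) =
        ∑ x ∈ c.support, c x • fun g => (b j : G → k) (x * g) := by
      ext g
      rw [hρ, LinearMap.toMatrix_apply]
      refine (hc _).trans ?_
      simp [Finsupp.sum, τ, rightTranslation, LinearMap.funLeft]
    rw [this]
    exact sum_mem fun x _ => Subalgebra.smul_mem _
      (comp_mul_left_mem_regularFunctions (hU _ (b j).2) x) _
  let e := b.equivFun ⟨1, h1⟩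
  have hfix (g : G) : (ρ g : Matrix _ _ k) *ᵥ e = e := by
    rw [hρv]
    rfl
  obtain ⟨W', hW', hinv⟩ := hred _ ρ hrat (Submodule.span k {e}) fun g v hv => by
    obtain ⟨a, rfl⟩ := Submodule.mem_span_singleton.1 hv
    rw [Matrix.mulVec_smul, hfix]
    exact hv
  have he : e ∉ W' := fun he => by
    have h0 := (Submodule.disjoint_def.1 hW'.disjoint) e (Submodule.mem_span_singleton_self e) he
    have h2 : (⟨1, h1⟩ : U) = 0 := (LinearEquiv.map_eq_zero_iff _).1 h0
    have := congrFun (congrArg Subtype.val h2) 1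
    simp at this
  obtain ⟨f, hf, hfW⟩ := Submodule.exists_le_ker_of_notMem he
  refine ⟨(f e)⁻¹ • f.comp b.equivFun.toLinearMap, inv_mul_cancel₀ hf, fun g u => ?_⟩
  simp only [LinearMap.smul_apply]
  congr 1
  change f (b.equivFun (τ g u)) = f (b.equivFun u)
  rw [← hρv]
  obtain ⟨w, hw, w', hw', hu⟩ := Submodule.mem_sup.1
    (hW'.sup_eq_top ▸ Submodule.mem_top : b.equivFun u ∈ Submodule.span k {e} ⊔ W')
  obtain ⟨a, rfl⟩ := Submodule.mem_span_singleton.1 hw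
  have z1 : f w' = 0 := hfW hw'
  have z2 : f ((ρ g : Matrix _ _ k) *ᵥ w') = 0 := hfW (hinv g w' hw')
  rw [← hu, Matrix.mulVec_add, Matrix.mulVec_smul, hfix, map_add, map_add, z1, z2]

theorem exists_invariant_functional (hred : IsReductiveSubgroup G) {κ : Type*} [Finite κ]
    (f : κ → G → k) (hf : ∀ i, f i ∈ regularFunctions G) :
    ∃ ℓ : (G → k) →ₗ[k] k, ℓ 1 = 1 ∧ ∀ i g, ℓ (fun x => f i (x * g)) = ℓ (f i) := by
  let T : Set (G → k) := insert 1 (Set.range fun ig : κ × G => rightTranslation G ig.2 (f ig.1))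
  let U := Submodule.span k T
  have hone : (1 : G → k) ∈ U := Submodule.subset_span (Set.mem_insert _ _)
  have hfin : FiniteDimensional k U := by
    choose ι _ p q hp hq h using fun i => exists_comul (hf i)
    let V : Submodule k (G → k) :=
      Submodule.span k (insert 1 (Set.range fun il : (Σ i, ι i) => p il.1 il.2))
    have hV : FiniteDimensional k V :=
      FiniteDimensional.span_of_finite k ((Set.finite_range _).insert _)
    refine Submodule.finiteDimensional_of_le (S₂ := V) (Submodule.span_le.2 ?_)
    rintro _ (rfl | ⟨⟨i, g⟩, rfl⟩)
    · exact Submodule.subset_span (Set.mem_insert _ _)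
    · have : rightTranslation G g (f i) = ∑ l, q i l g • p i l := by
        ext x
        simp [rightTranslation, LinearMap.funLeft, h, mul_comm]
      change rightTranslation G g (f i) ∈ V
      rw [this]
      exact sum_mem fun l _ => Submodule.smul_mem _ _
        (Submodule.subset_span (Set.mem_insert_of_mem _ ⟨⟨i, l⟩, rfl⟩))
  have hstab (g : G) : ∀ u ∈ U, rightTranslation G g u ∈ U := by
    intro u hu
    have hle : U ≤ U.comap (rightTranslation G g) := by
      refine Submodule.span_le.2 ?_
      rintro _ (rfl | ⟨⟨i, g'⟩, rfl⟩)
      · exact hone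
      · change rightTranslation G g (rightTranslation G g' (f i)) ∈ U
        rw [← Module.End.mul_apply, ← map_mul]
        exact Submodule.subset_span (Set.mem_insert_of_mem _ ⟨(i, g * g'), rfl⟩)
    exact hle hu
  have hreg : ∀ u ∈ U, u ∈ regularFunctions G := by
    have hle : U ≤ Subalgebra.toSubmodule (regularFunctions G) := by
      refine Submodule.span_le.2 ?_
      rintro _ (rfl | ⟨⟨i, g⟩, rfl⟩)
      · exact one_mem (regularFunctions G)
      · exact comp_mul_right_mem_regularFunctions (hf i) g
    exact fun u hu => hle hu
  obtain ⟨ℓ, h1, h2⟩ := exists_invariant_functional_of_stable hred U hreg hstab hone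
  obtain ⟨ℓ', hℓ'⟩ := LinearMap.exists_extend ℓ
  have hℓ (u : U) : ℓ' u = ℓ u := LinearMap.congr_fun hℓ' u
  refine ⟨ℓ', (hℓ ⟨1, hone⟩).trans h1, fun i g => ?_⟩
  have hfi : f i ∈ U := by
    refine Submodule.subset_span (Set.mem_insert_of_mem _ ⟨(i, 1), ?_⟩)
    simp
  exact (hℓ ⟨_, hstab g _ hfi⟩).trans ((h2 g ⟨f i, hfi⟩).trans (hℓ ⟨_, hfi⟩).symm)

end Averaging

section ClosedOrbit

variable {n m : ℕ} {G : Subgroup (GL (Fin n) k)}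

theorem mulVec_mem_regularFunctions {r : G →* GL (Fin m) k} (hrat : IsRationalRep G r)
    (x : Fin m → k) (j : Fin m) : (fun g => ((r g).val *ᵥ x) j) ∈ regularFunctions G := by
  have : (fun g => ((r g).val *ᵥ x) j) = ∑ l, x l • fun g => (r g).val j l := by
    ext g
    simp [Matrix.mulVec, dotProduct, mul_comm]
  rw [this]
  exact sum_mem fun l _ => Subalgebra.smul_mem _ (mem_regularFunctions_iff.2 (hrat j l)) _

theorem range_aeval_mulVec_le {r : G →* GL (Fin m) k} (hrat : IsRationalRep G r) (x : Fin m → k) :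
    (MvPolynomial.aeval fun j (g : G) => ((r g).val *ᵥ x) j).range ≤ regularFunctions G := by
  rw [← Algebra.adjoin_range_eq_range_aeval, Algebra.adjoin_le_iff]
  rintro _ ⟨j, rfl⟩
  exact mulVec_mem_regularFunctions hrat x j

/-- `F` is an `S`-equivariant regular map from `G` to the representation `σ` of the stabilizer `S`
of `x`, with values in the affine hull of the orbit of `y₀` scaled by the value of `a` on the orbit
of `x`. -/
structure IsScaledEquivariantMap (r : G →* GL (Fin m) k) (x : Fin m → k) {S : Subgroup G}
    {ι : Type} [Fintype ι] [DecidableEq ι] (σ : S →* Matrix ι ι k) (y₀ : ι → k)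
    (a : MvPolynomial (Fin m) k) (F : G → ι → k) : Prop where
  regular : ∀ i, (fun g => F g i) ∈ regularFunctions G
  equivariant : ∀ (g : G) (h : S), F (g * h) = σ h⁻¹ *ᵥ F g
  scaled : ∀ (φ : ι → k) (e : k), (∀ h, φ ⬝ᵥ (σ h *ᵥ y₀) = e) →
    ∀ g, φ ⬝ᵥ F g = MvPolynomial.eval ((r g).val *ᵥ x) a * e

theorem exists_scaled_equivariantMap [IsAlgClosed k] [CharZero k] (halg : IsAlgebraicSubgroup G)
    {r : G →* GL (Fin m) k} (hrat : IsRationalRep G r) (x : Fin m → k) {S : Subgroup G}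
    (hS : ∀ g, g ∈ S ↔ (r g).val *ᵥ x = x) {ι : Type} [Fintype ι] [DecidableEq ι]
    (σ : S →* Matrix ι ι k) (y₀ : ι → k) (Q : ι → G → k) (hQ : ∀ i, Q i ∈ regularFunctions G)
    (hQσ : ∀ i (h : S), Q i h = (σ h⁻¹ *ᵥ y₀) i) :
    ∃ a F, IsScaledEquivariantMap r x σ y₀ a F ∧
      ∃ g₀, MvPolynomial.eval ((r g₀).val *ᵥ x) a ≠ 0 := by
  choose κ _ p q hp hq hpq using fun i => exists_comul (hQ i)
  let A : Subalgebra k (G → k) :=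
    (MvPolynomial.aeval fun j (g : G) => ((r g).val *ᵥ x) j).range
  have hAB : A ≤ regularFunctions G := range_aeval_mulVec_le hrat x
  let p' : Option (Σ i, κ i) → regularFunctions G
    | none => 1
    | some il => ⟨_, comp_inv_mem_regularFunctions (hp il.1 il.2)⟩
  obtain ⟨c, hc, H⟩ := exists_generic_coefficients A (regularFunctions G) hAB regularFunctions_fg
    (exists_eq_eval_of_algHom halg) p' none rfl
  have hstab (y₁ y₂ : G) (h : ∀ a ∈ A, a y₁ = a y₂) : y₁⁻¹ * y₂ ∈ S := by
    have h' : (r y₁).val *ᵥ x = (r y₂).val *ᵥ x := by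
      ext j
      exact h (fun g => ((r g).val *ᵥ x) j) ⟨MvPolynomial.X j, by simp⟩
    rw [hS, map_mul, Units.val_mul, ← Matrix.mulVec_mulVec, ← h', Matrix.mulVec_mulVec,
      ← Units.val_mul, ← map_mul, inv_mul_cancel, map_one, Units.val_one, Matrix.one_mulVec]
  obtain ⟨a, ha⟩ := AlgHom.mem_range _ |>.1 (c none).2
  have ha' (g : G) : MvPolynomial.eval ((r g).val *ᵥ x) a = (c none : G → k) g := by
    rw [← ha, aeval_pi_apply]
  refine ⟨a, fun g i => ∑ l, (c (some ⟨i, l⟩) : G → k) g * q i l g, ⟨?_, ?_, ?_⟩, ?_⟩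
  · intro i
    have : (fun g => ∑ l, (c (some ⟨i, l⟩) : G → k) g * q i l g) =
        ∑ l, (c (some ⟨i, l⟩) : G → k) * q i l := by
      ext g; simp
    rw [this]
    exact sum_mem fun l _ => mul_mem (hAB (c _).2) (hq i l)
  · intro g h
    have hcg (z) : (c z : G → k) (g * h) = (c z : G → k) g := by
      obtain ⟨b, hb⟩ := AlgHom.mem_range _ |>.1 (c z).2
      rw [← hb, aeval_pi_apply, aeval_pi_apply, map_mul, Units.val_mul]
      simp only [← Matrix.mulVec_mulVec, (hS h).1 h.2]
    ext i
    let q' : Option (Σ i, κ i) → regularFunctions G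
      | none => 0
      | some il =>
        (if il.1 = i then ⟨_, comp_mul_right_mem_regularFunctions (hq il.1 il.2) h⟩ else 0) -
          σ h⁻¹ i il.1 • ⟨_, hq il.1 il.2⟩
    have hq'v (il : Σ i, κ i) (y : G) : (q' (some il) : G → k) y =
        (if il.1 = i then q il.1 il.2 (y * h) else 0) - σ h⁻¹ i il.1 * q il.1 il.2 y := by
      simp only [q']
      split_ifs <;> simp
    have hsum (u : Option (Σ i, κ i) → k) (y : G) :
        ∑ z, u z * (q' z : G → k) y = (∑ l, u (some ⟨i, l⟩) * q i l (y * h)) -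
          ∑ j, σ h⁻¹ i j * ∑ l, u (some ⟨j, l⟩) * q j l y := by
      rw [Fintype.sum_option, Fintype.sum_sigma]
      simp only [hq'v, mul_sub, Finset.sum_sub_distrib]
      have z0 : (q' none : G → k) y = 0 := rfl
      rw [z0, mul_zero, zero_add]
      congr 1
      · rw [Finset.sum_eq_single i (by intro b _ hb; simp [hb]) (by simp)]
        simp
      · simp only [Finset.mul_sum]
        exact Finset.sum_congr rfl fun _ _ => Finset.sum_congr rfl fun _ _ => by ring
    have := H q' (fun y₁ y₂ hy => ?_) g
    · rw [hsum (fun z => (c z : G → k) g)] at this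
      simp only [hcg]
      exact sub_eq_zero.1 this
    · rw [hsum (fun z => (p' z : G → k) y₁)]
      have hs := hstab y₁ y₂ hy
      have e1 : ∑ l, (p' (some ⟨i, l⟩) : G → k) y₁ * q i l (y₂ * h) = Q i (y₁⁻¹ * y₂ * h) := by
        rw [mul_assoc, hpq]
      have e2 (j) : ∑ l, (p' (some ⟨j, l⟩) : G → k) y₁ * q j l y₂ = Q j (y₁⁻¹ * y₂) := by
        rw [hpq]
      simp only [e1, e2]
      have e3 := hQσ i (⟨_, hs⟩ * h)
      rw [_root_.mul_inv_rev, map_mul, ← Matrix.mulVec_mulVec] at e3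
      rw [sub_eq_zero]
      refine e3.trans ?_
      rw [Matrix.mulVec, dotProduct]
      exact Finset.sum_congr rfl fun j _ => by rw [← hQσ j ⟨_, hs⟩]
  · intro φ e hφ g
    let q' : Option (Σ i, κ i) → regularFunctions G
      | none => algebraMap k _ (-e)
      | some il => φ il.1 • ⟨_, hq il.1 il.2⟩
    have hsum (u : Option (Σ i, κ i) → k) (y : G) :
        ∑ z, u z * (q' z : G → k) y = (φ ⬝ᵥ fun i => ∑ l, u (some ⟨i, l⟩) * q i l y) -
          u none * e := by
      rw [Fintype.sum_option, Fintype.sum_sigma]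
      have z0 : (q' none : G → k) y = -e := rfl
      have z1 (il) : (q' (some il) : G → k) y = φ il.1 * q il.1 il.2 y := rfl
      simp only [z0, z1, dotProduct, Finset.mul_sum, mul_left_comm (φ _)]
      ring
    rw [ha']
    have := H q' (fun y₁ y₂ hy => ?_) g
    · rw [hsum (fun z => (c z : G → k) g)] at this
      exact sub_eq_zero.1 this
    · rw [hsum (fun z => (p' z : G → k) y₁)]
      have hs := hstab y₁ y₂ hy
      have e2 (j) : ∑ l, (p' (some ⟨j, l⟩) : G → k) y₁ * q j l y₂ =
          (σ (⟨_, hs⟩ : S)⁻¹ *ᵥ y₀) j := by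
        rw [← hQσ j ⟨_, hs⟩, hpq]
      simp only [e2]
      have z0 : (p' none : G → k) y₁ = 1 := rfl
      rw [z0, one_mul, sub_eq_zero]
      exact hφ _
  · by_contra! h0
    refine hc (Subtype.ext (funext fun g => ?_))
    rw [← ha', h0]
    rfl

theorem IsScaledEquivariantMap.smul {r : G →* GL (Fin m) k} (hrat : IsRationalRep G r)
    {x : Fin m → k} {S : Subgroup G} (hS : ∀ g, g ∈ S ↔ (r g).val *ᵥ x = x)
    {ι : Type} [Fintype ι] [DecidableEq ι] {σ : S →* Matrix ι ι k} {y₀ : ι → k}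
    {a : MvPolynomial (Fin m) k} {F : G → ι → k} (hF : IsScaledEquivariantMap r x σ y₀ a F)
    (b : MvPolynomial (Fin m) k) :
    IsScaledEquivariantMap r x σ y₀ (b * a)
      (fun g => MvPolynomial.eval ((r g).val *ᵥ x) b • F g) where
  regular i := by
    have hb : (fun g => MvPolynomial.eval ((r g).val *ᵥ x) b) ∈ regularFunctions G := by
      have : MvPolynomial.aeval (fun j (g : G) => ((r g).val *ᵥ x) j) b ∈ regularFunctions G :=
        range_aeval_mulVec_le hrat x (AlgHom.mem_range_self _ b)
      have h (g : G) := aeval_pi_apply (fun j (g : G) => ((r g).val *ᵥ x) j) b g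
      rw [← funext h]
      exact this
    exact mul_mem hb (hF.regular i)
  equivariant g h := by
    rw [map_mul, Units.val_mul, ← Matrix.mulVec_mulVec, (hS h).1 h.2, hF.equivariant,
      Matrix.mulVec_smul]
  scaled φ e he g := by
    rw [dotProduct_smul, hF.scaled φ e he, map_mul, smul_eq_mul, mul_assoc]

theorem exists_equivariantMap_one [IsAlgClosed k] [CharZero k] (halg : IsAlgebraicSubgroup G)
    {r : G →* GL (Fin m) k} (hrat : IsRationalRep G r) (x : Fin m → k)
    (horb : IsZariskiClosedSet {v | ∃ g : G, v = (r g).val *ᵥ x}) {S : Subgroup G}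
    (hS : ∀ g, g ∈ S ↔ (r g).val *ᵥ x = x) {ι : Type} [Fintype ι] [DecidableEq ι]
    (σ : S →* Matrix ι ι k) (y₀ : ι → k) (Q : ι → G → k) (hQ : ∀ i, Q i ∈ regularFunctions G)
    (hQσ : ∀ i (h : S), Q i h = (σ h⁻¹ *ᵥ y₀) i) :
    ∃ F, IsScaledEquivariantMap r x σ y₀ 1 F := by
  let J : Ideal (MvPolynomial (Fin m) k) :=
    { carrier := {a | ∃ F, IsScaledEquivariantMap r x σ y₀ a F}
      zero_mem' := ⟨0, fun i => zero_mem (regularFunctions G), fun g h => by simp,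
        fun φ e _ g => by simp⟩
      add_mem' := by
        rintro a b ⟨F, hF⟩ ⟨F', hF'⟩
        refine ⟨F + F', fun i => add_mem (hF.regular i) (hF'.regular i), fun g h => ?_,
          fun φ e he g => ?_⟩
        · simp [hF.equivariant, hF'.equivariant, Matrix.mulVec_add]
        · simp [dotProduct_add, hF.scaled φ e he, hF'.scaled φ e he, add_mul]
      smul_mem' := fun b _ ⟨_, hF⟩ => ⟨_, hF.smul hrat hS b⟩ }
  have mem_J (a) : a ∈ J ↔ ∃ F, IsScaledEquivariantMap r x σ y₀ a F := Iff.rfl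
  clear_value J
  rw [← mem_J]
  obtain ⟨T, hT⟩ := horb
  have hempty : MvPolynomial.zeroLocus k J = ∅ := by
    rw [Set.eq_empty_iff_forall_notMem]
    intro v hv
    have hvo : v ∈ {v | ∃ g : G, v = (r g).val *ᵥ x} := by
      rw [hT]
      intro p hp
      have hpJ : p ∈ J := by
        refine (mem_J p).2 ⟨0, fun i => zero_mem (regularFunctions G), fun g h => by simp,
          fun φ e _ g => ?_⟩
        have : (r g).val *ᵥ x ∈ {v | ∃ g : G, v = (r g).val *ᵥ x} := ⟨g, rfl⟩
        rw [hT] at this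
        simp [this p hp]
      exact hv p hpJ
    obtain ⟨g₁, rfl⟩ := hvo
    obtain ⟨a, F, hF, g₀, ha⟩ := exists_scaled_equivariantMap halg hrat x hS σ y₀ Q hQ hQσ
    let a' : MvPolynomial (Fin m) k := MvPolynomial.bind₁
      (fun j => ∑ l, MvPolynomial.C ((r (g₀ * g₁⁻¹)).val j l) * MvPolynomial.X l) a
    have ha' (w : Fin m → k) : MvPolynomial.eval w a' =
        MvPolynomial.eval ((r (g₀ * g₁⁻¹)).val *ᵥ w) a := by
      simp only [a', ← MvPolynomial.coe_aeval_eq_eval, RingHom.coe_coe]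
      rw [MvPolynomial.aeval_bind₁]
      congr 2
      ext j
      simp [Matrix.mulVec, dotProduct]
    have hJ : a' ∈ J := by
      refine (mem_J a').2 ⟨fun g => F (g₀ * g₁⁻¹ * g), fun i =>
        comp_mul_left_mem_regularFunctions (hF.regular i) _, fun g h => ?_, fun φ e he g => ?_⟩
      · rw [← hF.equivariant, mul_assoc _ g]
      · rw [hF.scaled φ e he, ha', map_mul r (g₀ * g₁⁻¹), Units.val_mul, Matrix.mulVec_mulVec]
    have h0 : MvPolynomial.eval ((r g₁).val *ᵥ x) a' = 0 := hv a' hJ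
    rw [ha', Matrix.mulVec_mulVec, ← Units.val_mul, ← map_mul, inv_mul_cancel_right] at h0
    exact ha h0
  have hrad := MvPolynomial.vanishingIdeal_zeroLocus_eq_radical (K := k) J
  rw [hempty, MvPolynomial.vanishingIdeal_empty] at hrad
  rw [← Ideal.eq_top_iff_one]
  exact Ideal.radical_eq_top.1 hrad.symm

theorem exists_fixed_vector_mem_affineSpan_orbit [IsAlgClosed k] [CharZero k]
    (halg : IsAlgebraicSubgroup G) (hred : IsReductiveSubgroup G)
    {r : G →* GL (Fin m) k} (hrat : IsRationalRep G r) (x : Fin m → k)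
    (horb : IsZariskiClosedSet {v | ∃ g : G, v = (r g).val *ᵥ x}) {S : Subgroup G}
    (hS : ∀ g, g ∈ S ↔ (r g).val *ᵥ x = x) {ι : Type} [Fintype ι] [DecidableEq ι]
    (σ : S →* Matrix ι ι k) (y₀ : ι → k) (Q : ι → G → k) (hQ : ∀ i, Q i ∈ regularFunctions G)
    (hQσ : ∀ i (h : S), Q i h = (σ h⁻¹ *ᵥ y₀) i) :
    ∃ y : ι → k, (∀ h, σ h *ᵥ y = y) ∧
      ∀ (φ : ι → k) (e : k), (∀ h, φ ⬝ᵥ (σ h *ᵥ y₀) = e) → φ ⬝ᵥ y = e := by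
  obtain ⟨F, hF⟩ := exists_equivariantMap_one halg hrat x horb hS σ y₀ Q hQ hQσ
  obtain ⟨ℓ, hℓ1, hℓ⟩ := exists_invariant_functional hred (fun i g => F g i) hF.regular
  have hlin (φ : ι → k) : (φ ⬝ᵥ fun i => ℓ fun g => F g i) = ℓ fun g => φ ⬝ᵥ F g := by
    have : (fun g => φ ⬝ᵥ F g) = ∑ i, φ i • fun g => F g i := by
      ext g; simp [dotProduct]
    rw [this, map_sum]
    simp [dotProduct]
  refine ⟨fun i => ℓ fun g => F g i, fun h => ?_, fun φ e he => ?_⟩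
  · ext i
    refine (hlin _).trans ?_
    rw [← hℓ i (h⁻¹ : S)]
    congr 1
    ext g
    rw [hF.equivariant, inv_inv]
    rfl
  · rw [hlin]
    have : (fun g => φ ⬝ᵥ F g) = e • (1 : G → k) := by
      ext g
      simp [hF.scaled φ e he]
    rw [this, map_smul, hℓ1, smul_eq_mul, mul_one]

end ClosedOrbit


section Stabilizer

variable {n m : ℕ} {G : Subgroup (GL (Fin n) k)}

/-- The action of a group on matrices by conjugation, through a representation. -/
def conjugationRep {S : Type*} [Group S] {d : ℕ} (ρ : S →* GL (Fin d) k) :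
    S →* Matrix (Fin d × Fin d) (Fin d × Fin d) k where
  toFun s := Matrix.of fun i j => (ρ s).val i.1 j.1 * (ρ s⁻¹).val j.2 i.2
  map_one' := by
    ext i j
    simp only [inv_one, map_one, Units.val_one, Matrix.of_apply, Matrix.one_apply, Prod.ext_iff,
      ite_and, eq_comm (a := j.2)]
    split_ifs <;> simp
  map_mul' s t := by
    ext i j
    simp only [Matrix.of_apply, Matrix.mul_apply, _root_.mul_inv_rev, map_mul, Units.val_mul,
      Fintype.sum_prod_type, Finset.sum_mul_sum]
    exact Finset.sum_congr rfl fun _ _ => Finset.sum_congr rfl fun _ _ => by ring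

theorem conjugationRep_mulVec {S : Type*} [Group S] {d : ℕ} (ρ : S →* GL (Fin d) k) (s : S)
    (y : Fin d × Fin d → k) (i : Fin d × Fin d) :
    (conjugationRep ρ s *ᵥ y) i =
      ((ρ s).val * Matrix.of (fun a b => y (a, b)) * (ρ s⁻¹).val) i.1 i.2 := by
  simp only [conjugationRep, Matrix.mulVec, dotProduct, MonoidHom.coe_mk, OneHom.coe_mk,
    Matrix.of_apply, Matrix.mul_apply, Fintype.sum_prod_type, Finset.sum_mul]
  rw [Finset.sum_comm]
  exact Finset.sum_congr rfl fun _ _ => Finset.sum_congr rfl fun _ _ => by ring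

theorem exists_commuting_projection [IsAlgClosed k] [CharZero k]
    (halg : IsAlgebraicSubgroup G) (hred : IsReductiveSubgroup G)
    {r : G →* GL (Fin m) k} (hrat : IsRationalRep G r) (x : Fin m → k)
    (horb : IsZariskiClosedSet {v | ∃ g : G, v = (r g).val *ᵥ x}) {S : Subgroup G}
    (hS : ∀ g, g ∈ S ↔ (r g).val *ᵥ x = x) {d : ℕ} (ρ : S →* GL (Fin d) k)
    (R : Fin d → Fin d → G → k) (hR : ∀ i j, R i j ∈ regularFunctions G)
    (hRρ : ∀ i j (s : S), R i j s = (ρ s).val i j) (W : Submodule k (Fin d → k))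
    (hW : ∀ s, ∀ v ∈ W, (ρ s).val *ᵥ v ∈ W) :
    ∃ P : Matrix (Fin d) (Fin d) k, (∀ s, (ρ s).val * P = P * (ρ s).val) ∧
      (∀ v, P *ᵥ v ∈ W) ∧ ∀ v ∈ W, P *ᵥ v = v := by
  obtain ⟨P₀, hP₀, hP₀W⟩ : ∃ P₀ : Matrix (Fin d) (Fin d) k,
      (∀ v, P₀ *ᵥ v ∈ W) ∧ ∀ v ∈ W, P₀ *ᵥ v = v := by
    obtain ⟨f, hf⟩ := LinearMap.exists_leftInverse_of_injective W.subtype W.ker_subtype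
    refine ⟨LinearMap.toMatrix' (W.subtype.comp f), fun v => ?_, fun v hv => ?_⟩
    · rw [LinearMap.toMatrix'_mulVec]
      exact (f v).2
    · rw [LinearMap.toMatrix'_mulVec]
      exact congrArg Subtype.val (LinearMap.congr_fun hf ⟨v, hv⟩)
  let σ := conjugationRep ρ
  have hσ := conjugationRep_mulVec ρ
  have hσ₀ (s : S) : σ s *ᵥ (fun i => P₀ i.1 i.2) =
      fun i => ((ρ s).val * P₀ * (ρ s⁻¹).val) i.1 i.2 := funext (hσ s _)
  obtain ⟨y, hy, hφ⟩ := exists_fixed_vector_mem_affineSpan_orbit halg hred hrat x horb hS σ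
    (fun i => P₀ i.1 i.2)
    (fun i => ∑ b, (∑ a, P₀ a b • fun g => R i.1 a g⁻¹) * R b i.2)
    (fun i => sum_mem fun b _ => mul_mem (sum_mem fun a _ =>
      Subalgebra.smul_mem _ (comp_inv_mem_regularFunctions (hR _ _)) _) (hR _ _))
    (fun i s => by
      rw [hσ, inv_inv]
      have h (a) : R i.1 a (s : G)⁻¹ = (ρ s⁻¹).val i.1 a := hRρ _ _ s⁻¹
      simp only [Matrix.mul_apply, hRρ, h, Finset.sum_apply, Pi.mul_apply, Pi.smul_apply,
        smul_eq_mul, mul_comm (P₀ _ _), Matrix.of_apply])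
  let P : Matrix (Fin d) (Fin d) k := Matrix.of fun a b => y (a, b)
  have hinv (s : S) : (ρ s⁻¹).val * (ρ s).val = 1 := by
    rw [← Units.val_mul, ← map_mul, inv_mul_cancel, map_one, Units.val_one]
  have hinv' (s : S) : (ρ s).val * (ρ s⁻¹).val = 1 := by
    rw [← Units.val_mul, ← map_mul, mul_inv_cancel, map_one, Units.val_one]
  have hP₀' : (Matrix.of fun a b => P₀ a b) = P₀ := rfl
  refine ⟨P, fun s => ?_, fun v => ?_, fun v hv => ?_⟩
  · have h : (ρ s).val * P * (ρ s⁻¹).val = P := by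
      ext a b
      rw [← hσ s y (a, b), hy]
      rfl
    conv_rhs => rw [← h]
    rw [mul_assoc _ (ρ s⁻¹).val, hinv, mul_one]
  · by_contra hv
    obtain ⟨ψ, hψ, hψW⟩ := Submodule.exists_le_ker_of_notMem hv
    have hψs (w : Fin d → k) : ψ w = ∑ a, w a * ψ (Pi.single a 1) := by
      conv_lhs => rw [pi_eq_sum_univ' w, map_sum]
      simp
    have key (M : Matrix (Fin d) (Fin d) k) :
        (fun i : Fin d × Fin d => ψ (Pi.single i.1 1) * v i.2) ⬝ᵥ (fun i => M i.1 i.2) =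
          ψ (M *ᵥ v) := by
      rw [hψs]
      simp only [dotProduct, Fintype.sum_prod_type, Matrix.mulVec, Finset.sum_mul]
      exact Finset.sum_congr rfl fun _ _ => Finset.sum_congr rfl fun _ _ => by ring
    refine hψ ((key P).symm.trans (hφ _ 0 fun s => ?_))
    rw [hσ₀, key,
      mul_assoc, ← Matrix.mulVec_mulVec, ← Matrix.mulVec_mulVec]
    exact hψW (hW s _ (hP₀ _))
  · ext c
    have key (M : Matrix (Fin d) (Fin d) k) :
        (fun i : Fin d × Fin d => if i.1 = c then v i.2 else 0) ⬝ᵥ (fun i => M i.1 i.2) =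
          (M *ᵥ v) c := by
      simp [dotProduct, Fintype.sum_prod_type, Matrix.mulVec, mul_comm]
    refine (key P).symm.trans (hφ _ (v c) fun s => ?_)
    rw [hσ₀, key,
      mul_assoc, ← Matrix.mulVec_mulVec, ← Matrix.mulVec_mulVec, hP₀W _ (hW _ _ hv),
      Matrix.mulVec_mulVec, hinv', Matrix.one_mulVec]

theorem isReductiveSubgroup_map_stabilizer [IsAlgClosed k] [CharZero k]
    (halg : IsAlgebraicSubgroup G) (hred : IsReductiveSubgroup G)
    {r : G →* GL (Fin m) k} (hrat : IsRationalRep G r) (x : Fin m → k)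
    (horb : IsZariskiClosedSet {v | ∃ g : G, v = (r g).val *ᵥ x}) (S : Subgroup G)
    (hS : ∀ g, g ∈ S ↔ (r g).val *ᵥ x = x) : IsReductiveSubgroup (S.map G.subtype) := by
  intro d ρ hρ W hW
  let ρS : S →* GL (Fin d) k := ρ.comp (G.subtype.subgroupMap S)
  choose p hp using hρ
  let R (i j : Fin d) (g : G) : k := MvPolynomial.eval (glCoords (g : GL (Fin n) k)) (p i j)
  have hR (i j) : R i j ∈ regularFunctions G := mem_regularFunctions_iff.2 ⟨p i j, fun _ => rfl⟩
  have hRρ (i j) (s : S) : R i j s = (ρS s).val i j :=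
    (hp i j (G.subtype.subgroupMap S s)).symm
  have hWS (s : S) : ∀ v ∈ W, (ρS s).val *ᵥ v ∈ W :=
    hW (G.subtype.subgroupMap S s)
  clear_value R
  obtain ⟨P, hcomm, hmem, hfix⟩ :=
    exists_commuting_projection halg hred hrat x horb hS ρS R hR hRρ W hWS
  refine ⟨LinearMap.ker P.mulVecLin, ?_, ?_⟩
  · exact (LinearMap.IsProj.mk (f := P.mulVecLin) hmem hfix).isCompl
  · rintro ⟨_, g, hg, rfl⟩ v hv
    rw [LinearMap.mem_ker, Matrix.mulVecLin_apply] at hv ⊢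
    have h := hcomm ⟨g, hg⟩
    have hg' : ρ ⟨G.subtype g, g, hg, rfl⟩ = ρS ⟨g, hg⟩ := rfl
    rw [hg', Matrix.mulVec_mulVec, ← h, ← Matrix.mulVec_mulVec, hv, Matrix.mulVec_zero]

end Stabilizer

/-- Matsushima's criterion (Proposition 2.1): if a reductive algebraic group `G` acts
(by a rational linear representation `r`, in which the affine `G`-variety `X` is
equivariantly embedded) and the orbit of a point `x ∈ X` is closed, then the stabilizer
`G_x` is reductive. -/
theorem stabilizer_of_closed_orbit_reductive
    [IsAlgClosed k] [CharZero k]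
    {n m : ℕ} (G : Subgroup (GL (Fin n) k))
    (halg : IsAlgebraicSubgroup G) (hred : IsReductiveSubgroup G)
    (r : G →* GL (Fin m) k) (hrat : IsRationalRep G r)
    (X : Set (Fin m → k)) (hX : IsZariskiClosedSet X)
    (hstab : ∀ (g : G), ∀ v ∈ X, (r g : Matrix (Fin m) (Fin m) k).mulVec v ∈ X)
    (x : Fin m → k) (hx : x ∈ X)
    (horb : IsZariskiClosedSet
      {v | ∃ g : G, v = (r g : Matrix (Fin m) (Fin m) k).mulVec x}) :
    IsReductiveSubgroup
      (Subgroup.map G.subtype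
        { carrier := {g : G | (r g : Matrix (Fin m) (Fin m) k).mulVec x = x}
          one_mem' := by simp
          mul_mem' := by
            intro a b ha hb
            simp only [Set.mem_setOf_eq] at *
            rw [_root_.map_mul]
            simp only [Units.val_mul, ← Matrix.mulVec_mulVec, hb, ha]
          inv_mem' := by
            intro a ha
            simp only [Set.mem_setOf_eq] at *
            conv_lhs => rw [← ha]
            rw [Matrix.mulVec_mulVec, ← Units.val_mul, ← _root_.map_mul,
              inv_mul_cancel, _root_.map_one, Units.val_one, Matrix.one_mulVec] }) := by
  exact isReductiveSubgroup_map_stabilizer halg hred hrat x horb _ fun _ => Iff.rfl
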